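/- (Theorem 2, converse direction) Let K ≥ 2 and J ≥ 1 be integers with 2J > K. Then there exist two J-class latent class models (ν_Q, λ_Q), (ν_R, λ_R) ∈ Q_J such that π̃_{Q,h} = π̃_{R,h} for all h ∈ H* but π_{Q,0} ≠ π_{R,0}. In particular, the family Q_J is not identifiable. -/

import Mathlib

open Finset

/-- The set `H* = {0,1}^K \ {0}` of nonzero binary inclusion patterns. -/
def Hstar (K : ℕ) : Finset (Fin K → Bool) :=
  Finset.univ.filter (fun h => h ≠ fun _ => false)

/-- Cell probability `π_h = Σ_j ν_j ∏_k λ_{jk}^{h_k} (1-λ_{jk})^{1-h_k}` of a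
    `J`-class latent class model. -/
def lcmCellProb {J K : ℕ} (ν : Fin J → ℝ) (lam : Fin J → Fin K → ℝ)
    (h : Fin K → Bool) : ℝ :=
  ∑ j, ν j * ∏ k, (if h k then lam j k else 1 - lam j k)

/-- Missing cell probability `π_0` of a latent class model. -/
def lcmMissProb {J K : ℕ} (ν : Fin J → ℝ) (lam : Fin J → Fin K → ℝ) : ℝ :=
  lcmCellProb ν lam (fun _ => false)

/-- Conditional cell probability `π̃_h = π_h / (1 − π_0)`. -/
noncomputable def lcmCondCellProb {J K : ℕ} (ν : Fin J → ℝ)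
    (lam : Fin J → Fin K → ℝ) (h : Fin K → Bool) : ℝ :=
  lcmCellProb ν lam h / (1 - lcmMissProb ν lam)

/-- Membership in the family `Q_J`: nonnegative weights summing to one, class
    probabilities in `(0,1]`, and coordinatewise distinct class probabilities. -/
def memQJ {J K : ℕ} (ν : Fin J → ℝ) (lam : Fin J → Fin K → ℝ) : Prop :=
  (∀ j, 0 ≤ ν j) ∧ (∑ j, ν j = 1) ∧
    (∀ j k, lam j k ∈ Set.Ioc (0 : ℝ) 1) ∧
    (∀ j j', j ≠ j' → ∀ k, lam j k ≠ lam j' k)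

/-- Splitting a sum over `{0, …, 2J}` into the zero, odd and positive even indices. -/
lemma sum_range_two_mul_add_one (f : ℕ → ℝ) (J : ℕ) :
    ∑ i ∈ range (2 * J + 1), f i =
      f 0 + ∑ j ∈ range J, f (2 * j + 1) + ∑ j ∈ range J, f (2 * j + 2) := by
  induction J with
  | zero => simp
  | succ J ih =>
    rw [show 2 * (J + 1) + 1 = 2 * J + 1 + 1 + 1 by ring, sum_range_succ, sum_range_succ, ih,
      sum_range_succ, sum_range_succ]
    ring

/-- The odd and even halves of the vanishing `2J`-th finite difference of a polynomial of
degree less than `2J` agree. -/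
lemma eval_zero_add_sum_even_eq_sum_odd {J : ℕ} (P : Polynomial ℝ) (hP : P.natDegree < 2 * J) :
    P.eval 0 + ∑ j : Fin J, ((2 * J).choose (2 * j + 2) : ℝ) * P.eval (2 * (j : ℝ) + 2) =
      ∑ j : Fin J, ((2 * J).choose (2 * j + 1) : ℝ) * P.eval (2 * (j : ℝ) + 1) := by
  have h := congrFun (Polynomial.fwdDiff_iter_eq_zero_of_degree_lt hP) 0
  rw [fwdDiff_iter_eq_sum_shift, sum_range_two_mul_add_one] at h
  have hodd : ∀ j ∈ range J, (-1 : ℤ) ^ (2 * J - (2 * j + 1)) = -1 := fun j hj =>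
    Odd.neg_one_pow ⟨J - j - 1, by have := mem_range.1 hj; omega⟩
  have heven : ∀ j ∈ range J, (-1 : ℤ) ^ (2 * J - (2 * j + 2)) = 1 := fun j hj =>
    Even.neg_one_pow ⟨J - j - 1, by have := mem_range.1 hj; omega⟩
  rw [sum_congr rfl fun j hj => by rw [hodd j hj],
    sum_congr (s₁ := range J) (f := fun j => ((-1 : ℤ) ^ (2 * J - (2 * j + 2)) * _) • _) rfl
      fun j hj => by rw [heven j hj]] at h
  rw [Fin.sum_univ_eq_sum_range
      (fun j => ((2 * J).choose (2 * j + 2) : ℝ) * P.eval (2 * (j : ℝ) + 2)),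
    Fin.sum_univ_eq_sum_range
      (fun j => ((2 * J).choose (2 * j + 1) : ℝ) * P.eval (2 * (j : ℝ) + 1))]
  simp at h
  linarith

/-- The conditional probability of the pattern `h` in a class with common sampling probability
`x / n`, as a polynomial in `x`. -/
noncomputable def patternPoly {K : ℕ} (n : ℝ) (h : Fin K → Bool) : Polynomial ℝ :=
  ∏ k, if h k then Polynomial.C n⁻¹ * Polynomial.X else 1 - Polynomial.C n⁻¹ * Polynomial.X

lemma eval_patternPoly {K : ℕ} (n x : ℝ) (h : Fin K → Bool) :
    (patternPoly n h).eval x = ∏ k, if h k then x / n else 1 - x / n := by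
  rw [patternPoly, Polynomial.eval_prod]
  refine prod_congr rfl fun k _ => ?_
  split_ifs <;> simp [div_eq_inv_mul]

lemma natDegree_patternPoly_le {K : ℕ} (n : ℝ) (h : Fin K → Bool) :
    (patternPoly n h).natDegree ≤ K := by
  refine (Polynomial.natDegree_prod_le _ _).trans
    ((sum_le_card_nsmul _ _ 1 fun k _ => ?_).trans (by simp))
  split_ifs <;> compute_degree

lemma eval_zero_patternPoly {K : ℕ} (n : ℝ) (h : Fin K → Bool) :
    (patternPoly n h).eval 0 = if h = fun _ => false then 1 else 0 := by
  rw [eval_patternPoly]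
  split_ifs with h0
  · simp [h0]
  · obtain ⟨k, hk⟩ := Function.ne_iff.1 h0
    exact prod_eq_zero (mem_univ k) (by simp_all)

lemma lcmMissProb_lt_one {J K : ℕ} (hJ : 0 < J) (hK : K ≠ 0) {ν : Fin J → ℝ}
    {lam : Fin J → Fin K → ℝ} (hν : ∀ j, 0 < ν j) (hsum : ∑ j, ν j = 1)
    (hlam : ∀ j k, lam j k ∈ Set.Ioc (0 : ℝ) 1) : lcmMissProb ν lam < 1 := by
  have : Nonempty (Fin J) := ⟨⟨0, hJ⟩⟩
  have : NeZero K := ⟨hK⟩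
  rw [← hsum]
  refine sum_lt_sum_of_nonempty univ_nonempty fun j _ => mul_lt_of_lt_one_right (hν j) ?_
  simp only [Bool.false_eq_true, if_false]
  rw [← mul_prod_erase _ _ (mem_univ (0 : Fin K))]
  refine lt_of_le_of_lt (mul_le_of_le_one_right (sub_nonneg.2 (hlam j 0).2) ?_)
    (sub_lt_self 1 (hlam j 0).1)
  exact prod_le_one (fun k _ => sub_nonneg.2 (hlam j k).2)
    fun k _ => sub_le_self 1 (hlam j k).1.le

lemma lcmCellProb_div {J K : ℕ} (w : Fin J → ℝ) (S : ℝ) (lam : Fin J → Fin K → ℝ)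
    (h : Fin K → Bool) : lcmCellProb (fun j => w j / S) lam h = lcmCellProb w lam h / S := by
  simp only [lcmCellProb, sum_div, div_mul_eq_mul_div]

/-- Normalizing positive weights and using a distinct sampling probability per class, common to all
coordinates, gives a member of `Q_J`. -/
lemma memQJ_normalize {J K : ℕ} (hJ : 0 < J) {w x : Fin J → ℝ} (hw : ∀ j, 0 < w j)
    (hx : ∀ j, x j ∈ Set.Ioc (0 : ℝ) 1) (hinj : Function.Injective x) :
    memQJ (fun j => w j / ∑ i, w i) (fun j (_ : Fin K) => x j) := by
  have : Nonempty (Fin J) := ⟨⟨0, hJ⟩⟩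
  have hS : 0 < ∑ i, w i := sum_pos (fun i _ => hw i) univ_nonempty
  refine ⟨fun j => (div_pos (hw j) hS).le, ?_, fun j _ => hx j, fun j j' hne _ => hinj.ne hne⟩
  rw [← sum_div, div_self hS.ne']

/-- Theorem 2, converse direction: if `2J > K`, then there are
    two models in `Q_J` with identical conditional cell probabilities but
    different missing cell probabilities; in particular `Q_J` is not
    identifiable. -/
theorem lcm_not_identifiable_of_lt (K J : ℕ) (hK : 2 ≤ K) (hJ : 1 ≤ J)
    (hJK : K < 2 * J) :
    ∃ (νQ νR : Fin J → ℝ) (lamQ lamR : Fin J → Fin K → ℝ),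
      memQJ νQ lamQ ∧ memQJ νR lamR ∧
      (∀ h ∈ Hstar K, lcmCondCellProb νQ lamQ h = lcmCondCellProb νR lamR h) ∧
      lcmMissProb νQ lamQ ≠ lcmMissProb νR lamR := by
  have hJ0 : 0 < J := hJ
  have : Nonempty (Fin J) := ⟨⟨0, hJ0⟩⟩
  have hJR : (0 : ℝ) < 2 * J := by positivity
  set wQ : Fin J → ℝ := fun j => (2 * J).choose (2 * j + 2)
  set wR : Fin J → ℝ := fun j => (2 * J).choose (2 * j + 1)
  set xQ : Fin J → ℝ := fun j => (2 * (j : ℝ) + 2) / (2 * J)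
  set xR : Fin J → ℝ := fun j => (2 * (j : ℝ) + 1) / (2 * J)
  have hjJ (j : Fin J) : (j : ℝ) + 1 ≤ J := by exact_mod_cast j.isLt
  have wQ_pos (j : Fin J) : 0 < wQ j := by
    exact Nat.cast_pos.2 (Nat.choose_pos (by have := j.isLt; omega))
  have wR_pos (j : Fin J) : 0 < wR j := by
    exact Nat.cast_pos.2 (Nat.choose_pos (by have := j.isLt; omega))
  have xQ_mem (j : Fin J) : xQ j ∈ Set.Ioc (0 : ℝ) 1 :=
    ⟨by positivity, (div_le_one hJR).2 (by linarith [hjJ j])⟩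
  have xR_mem (j : Fin J) : xR j ∈ Set.Ioc (0 : ℝ) 1 :=
    ⟨by positivity, (div_le_one hJR).2 (by linarith [hjJ j])⟩
  have xQ_inj : Function.Injective xQ := fun i j hij => by
    have := (div_left_inj' hJR.ne').1 hij
    exact Fin.ext (by exact_mod_cast (by linarith : (i : ℝ) = j))
  have xR_inj : Function.Injective xR := fun i j hij => by
    have := (div_left_inj' hJR.ne').1 hij
    exact Fin.ext (by exact_mod_cast (by linarith : (i : ℝ) = j))
  have hS : 1 + ∑ j, wQ j = ∑ j, wR j := by
    simpa using eval_zero_add_sum_even_eq_sum_odd (J := J) 1 (by simpa using hJ0)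
  have hcell (h : Fin K → Bool) : (if h = fun _ => false then (1 : ℝ) else 0) +
      lcmCellProb wQ (fun j _ => xQ j) h = lcmCellProb wR (fun j _ => xR j) h := by
    have := eval_zero_add_sum_even_eq_sum_odd (patternPoly (2 * J : ℝ) h)
      ((natDegree_patternPoly_le _ h).trans_lt hJK)
    rw [eval_zero_patternPoly] at this
    simp only [eval_patternPoly] at this
    exact this
  have hSQ : 0 < ∑ j, wQ j := sum_pos (fun j _ => wQ_pos j) univ_nonempty
  have hSR : 0 < ∑ j, wR j := sum_pos (fun j _ => wR_pos j) univ_nonempty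
  have hQ := memQJ_normalize (K := K) hJ0 wQ_pos xQ_mem xQ_inj
  have hR := memQJ_normalize (K := K) hJ0 wR_pos xR_mem xR_inj
  have missQ := lcmMissProb_lt_one hJ0 (by omega) (fun j => div_pos (wQ_pos j) hSQ) hQ.2.1 hQ.2.2.1
  rw [lcmMissProb, lcmCellProb_div, div_lt_one hSQ] at missQ
  have hmiss := hcell fun _ => false
  rw [if_pos rfl] at hmiss
  refine ⟨_, _, _, _, hQ, hR, fun h hh => ?_, fun heq => ?_⟩
  · have hcell_h := hcell h
    rw [if_neg (mem_filter.1 hh).2, zero_add] at hcell_h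
    simp only [lcmCondCellProb, lcmMissProb, lcmCellProb_div]
    rw [one_sub_div hSQ.ne', one_sub_div hSR.ne', div_div_div_cancel_right₀ hSQ.ne',
      div_div_div_cancel_right₀ hSR.ne', hcell_h, ← hmiss, ← hS, add_sub_add_left_eq_sub]
  · simp only [lcmMissProb, lcmCellProb_div] at heq
    rw [div_eq_div_iff hSQ.ne' hSR.ne', ← hmiss, ← hS] at heq
    linarith
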